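/- arXiv:2511.00582 — 2 statements merged into one kernel-verified Lean document; each statement's English description precedes it below -/
import Mathlib

section
/- Let G be a connected undirected graph consisting of a single cycle (i.e., G is a cycle graph), and fix a root node n0. Then, starting from any spanning tree T of G rooted at n0, any other spanning tree T' of G rooted at n0 can be reached by a finite sequence of valid edge rotations, where each intermediate configuration is a spanning tree rooted at n0. -/
open SimpleGraph

/-- `T` is a spanning tree of `G`: a subgraph of `G` (on the full node set) that is
connected and contains no cycles, i.e. is a tree. -/
def IsSpanningTreeOf {V : Type*} (G T : SimpleGraph V) : Prop :=
  T ≤ G ∧ T.IsTree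

/-- In the tree `T` rooted at `n0`, a node `u` is *downward* of the edge `e` if every
path in `T` from the root `n0` to `u` uses the edge `e` (in a tree the path is unique). -/
def Downward {V : Type*} (T : SimpleGraph V) (n0 : V) (e : Sym2 V) (u : V) : Prop :=
  ∀ p : T.Walk n0 u, p.IsPath → e ∈ p.edges

/-- `(n, m)` is an edge of `T` oriented away from the root `n0`, with tail `n` and
head `m`; i.e. the edge is present in `T` and its head `m` lies downward of it. -/
def OrientedEdge {V : Type*} (T : SimpleGraph V) (n0 : V) (n m : V) : Prop :=
  T.Adj n m ∧ Downward T n0 s(n, m) m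

/-- The spanning subgraph `T + e' - e` obtained from `T` by replacing the edge
`e = {n, m}` with the edge `e' = {n', m}`. -/
def rotate {V : Type*} (T : SimpleGraph V) (n m n' : V) : SimpleGraph V :=
  T.deleteEdges {s(n, m)} ⊔ SimpleGraph.fromEdgeSet {s(n', m)}

/-- `T'` is obtained from `T` by one valid edge rotation (relative to the ambient
graph `G` and root `n0`): an edge `e = (n,m)` of `T` (oriented away from `n0`) is
replaced by an edge `e' = {n',m}` of `G` not in `T` with the same head `m`, where
`n'` is not downward of `e` in `T`. -/
def ValidRotation {V : Type*} (G : SimpleGraph V) (n0 : V) (T T' : SimpleGraph V) : Prop :=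
  ∃ n m n', OrientedEdge T n0 n m ∧ G.Adj n' m ∧ ¬ T.Adj n' m ∧
    ¬ Downward T n0 s(n, m) n' ∧ T' = rotate T n m n'

lemma downward_iff_not_reachable_deleteEdges {V : Type*} {T : SimpleGraph V} {n0 u : V}
    {e : Sym2 V} : Downward T n0 e u ↔ ¬ (T.deleteEdges {e}).Reachable n0 u := by
  refine ⟨fun h hr ↦ ?_, fun h p _ ↦ p.mem_edges_of_not_reachable_deleteEdges h⟩
  obtain ⟨p, hp⟩ := hr.exists_isPath
  have he := h (p.mapLe (deleteEdges_le _)) (hp.mapLe _)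
  rw [Walk.edges_mapLe_eq_edges] at he
  simpa using p.edges_subset_edgeSet he

lemma SimpleGraph.Reachable.deleteEdges_of_not_reachable {V : Type*} {H : SimpleGraph V}
    {a v n m : V} (hv : H.Reachable a v) (hm : ¬ H.Reachable a m) :
    (H.deleteEdges {s(n, m)}).Reachable a v := by
  classical
  obtain ⟨w⟩ := hv
  by_contra h
  have he := w.mem_edges_of_not_reachable_deleteEdges h
  exact hm ⟨w.takeUntil m (w.snd_mem_support_of_mem_edges he)⟩

lemma SimpleGraph.Connected.reachable_deleteEdges_or {V : Type*} {T : SimpleGraph V}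
    (hT : T.Connected) (n m v : V) :
    (T.deleteEdges {s(n, m)}).Reachable v n ∨ (T.deleteEdges {s(n, m)}).Reachable v m := by
  have key : ∀ {a b : V}, T.Walk a b → b = n →
      (T.deleteEdges {s(n, m)}).Reachable a n ∨ (T.deleteEdges {s(n, m)}).Reachable a m := by
    intro a b w hb
    induction w with
    | nil => exact .inl (hb ▸ .refl _)
    | @cons a c _ h _ ih =>
      by_cases he : s(a, c) = s(n, m)
      · rcases Sym2.eq_iff.1 he with ⟨rfl, _⟩ | ⟨rfl, _⟩
        · exact .inl (.refl _)
        · exact .inr (.refl _)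
      · have hac : (T.deleteEdges {s(n, m)}).Reachable a c :=
          Adj.reachable (deleteEdges_adj.2 ⟨h, by simpa using he⟩)
        exact (ih hb).imp hac.trans hac.trans
  obtain ⟨w⟩ := hT.preconnected v n
  exact key w rfl

/-- A valid rotation turns a tree into a tree. -/
lemma isTree_rotate {V : Type*} {T : SimpleGraph V} {n0 n m n' : V} (hT : T.IsTree)
    (hnm : OrientedEdge T n0 n m) (hn' : ¬ Downward T n0 s(n, m) n') :
    (rotate T n m n').IsTree := by
  have hm := downward_iff_not_reachable_deleteEdges.1 hnm.2
  rw [downward_iff_not_reachable_deleteEdges, not_not] at hn'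
  have hn := (hT.connected.reachable_deleteEdges_or n m n0).resolve_right hm
  have hle : T.deleteEdges {s(n, m)} ≤ rotate T n m n' := le_sup_left
  have hne : n' ≠ m := fun h ↦ hm (h ▸ hn')
  have hadj : (rotate T n m n').Adj n' m := Or.inr (by simp [hne])
  refine ⟨(connected_iff_exists_forall_reachable _).2 ⟨n0, fun v ↦ ?_⟩, ?_⟩
  · rcases hT.connected.reachable_deleteEdges_or n m v with h | h
    · exact (hn.trans h.symm).mono hle
    · exact (hn'.mono hle).trans (hadj.reachable.trans (h.symm.mono hle))
  · exact IsAcyclic.sup_edge_of_not_reachable (fun h ↦ hm (hn'.trans h))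
      (hT.isAcyclic.anti (deleteEdges_le _))

lemma exists_orientedEdge {V : Type*} {T : SimpleGraph V} (hT : T.IsTree) {n0 m : V}
    (hm : m ≠ n0) : ∃ n, OrientedEdge T n0 n m := by
  obtain ⟨p, hp⟩ := hT.connected.exists_isPath m n0
  cases p with
  | nil => exact absurd rfl hm
  | @cons _ n _ h q =>
    refine ⟨n, h.symm, fun p' hp' ↦ ?_⟩
    have := congrArg Subtype.val
      ((hT.isAcyclic.subsingleton_path _ _).elim ⟨p', hp'⟩ ⟨(Walk.cons h q).reverse, hp.reverse⟩)
    simp only at this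
    simp [this, Sym2.eq_swap]

/-- In an arbitrary finite graph, any two spanning trees are related by a sequence of valid edge
rotations. -/
theorem reflTransGen_validRotation {V : Type*} [Finite V] {G : SimpleGraph V} (n0 : V)
    {T T' : SimpleGraph V} (hT : IsSpanningTreeOf G T) (hT' : IsSpanningTreeOf G T') :
    Relation.ReflTransGen (ValidRotation G n0) T T' := by
  induction hk : {v | ¬ (T ⊓ T').Reachable n0 v}.ncard using Nat.strong_induction_on
    generalizing T with
  | _ k ih =>
  by_cases hall : ∀ v, (T ⊓ T').Reachable n0 v
  · have hc : (T ⊓ T').Connected := (connected_iff_exists_forall_reachable _).2 ⟨n0, hall⟩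
    have h₁ := (isTree_iff_minimal_connected.1 hT.2).le_of_le hc inf_le_left
    have h₂ := (isTree_iff_minimal_connected.1 hT'.2).le_of_le hc inf_le_right
    rw [le_antisymm (h₁.trans inf_le_right) (h₂.trans inf_le_left)]
  push Not at hall
  obtain ⟨v, hv⟩ := hall
  obtain ⟨w⟩ := hT'.2.connected.preconnected n0 v
  obtain ⟨⟨⟨n', m⟩, hadj⟩, -, hn', hm⟩ :=
    w.exists_boundary_dart {v | (T ⊓ T').Reachable n0 v} (Reachable.refl _) hv
  simp only [Set.mem_ofPred_eq] at hn' hm hadj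
  obtain ⟨n, hnm⟩ := exists_orientedEdge hT.2 (n0 := n0) (m := m)
    (by rintro rfl; exact hm (.refl _))
  have hTadj : ¬ T.Adj n' m := fun h ↦
    hm (hn'.trans (Adj.reachable (G := T ⊓ T') ⟨h, hadj⟩))
  have hdown : ¬ Downward T n0 s(n, m) n' := by
    rw [downward_iff_not_reachable_deleteEdges, not_not]
    exact (hn'.deleteEdges_of_not_reachable hm).mono (deleteEdges_mono inf_le_left)
  have hle : (T ⊓ T').deleteEdges {s(n, m)} ≤ rotate T n m n' ⊓ T' :=
    le_inf ((deleteEdges_mono inf_le_left).trans le_sup_left)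
      ((deleteEdges_le _).trans inf_le_right)
  have hreach : ∀ u, (T ⊓ T').Reachable n0 u → (rotate T n m n' ⊓ T').Reachable n0 u :=
    fun u hu ↦ (hu.deleteEdges_of_not_reachable hm).mono hle
  have hadj' : (rotate T n m n' ⊓ T').Adj n' m := ⟨Or.inr (by simp [hadj.ne]), hadj⟩
  have hspan : IsSpanningTreeOf G (rotate T n m n') := by
    refine ⟨sup_le ((deleteEdges_le _).trans hT.1) ?_, isTree_rotate hT.2 hnm hdown⟩
    rw [fromEdgeSet_le]
    rintro e ⟨rfl, -⟩
    exact hT'.1 hadj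
  refine .head ⟨n, m, n', hnm, hT'.1 hadj, hTadj, hdown, rfl⟩ (ih _ ?_ hspan rfl)
  rw [← hk]
  refine Set.ncard_lt_ncard ⟨fun u hu h ↦ hu (hreach u h), fun h ↦ ?_⟩
  exact h hm ((hreach n' hn').trans hadj'.reachable)

/-- If `G` is a cycle graph (connected, every node of degree `2`) with
root `n0`, then any spanning tree `T'` of `G` rooted at `n0` can be reached from any
spanning tree `T` rooted at `n0` by a finite sequence of valid edge rotations. -/
theorem stmt2 {V : Type*} [Fintype V] [DecidableEq V]
    (G : SimpleGraph V) [DecidableRel G.Adj] (n0 : V)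
    (hconn : G.Connected) (hcycle : ∀ v : V, G.degree v = 2)
    (T T' : SimpleGraph V)
    (hT : IsSpanningTreeOf G T) (hT' : IsSpanningTreeOf G T') :
    Relation.ReflTransGen (ValidRotation G n0) T T' := by
  exact reflTransGen_validRotation n0 hT hT'
end

section
/- Let I be a Set Cover instance with universe U = {u_1, ..., u_nu} (nu >= 1) and collection of subsets S = {S_1, ..., S_mu} whose union is U, and let I' be the MDST instance produced from I by the forward mapping. Let T be a spanning tree of the graph of I', and let x be the set cover obtained from T by the backward mapping. If C(T) <= rho * OPT(I') for some real rho >= 1, then |x| <= sqrt(2 * rho) * OPT(I). -/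
open SimpleGraph
open scoped Classical

/-- The flow on the oriented tree edge `(a, b)` determined by Kirchhoff's current law:
the sum of the demands over all nodes downward of the edge. -/
noncomputable def edgeFlow {V : Type*} [Fintype V] (T : SimpleGraph V) (n0 : V)
    (f : V → ℝ) (a b : V) : ℝ :=
  ∑ u : V, if Downward T n0 s(a, b) u then f u else 0

/-- The dissipation cost `C(T) = ∑_{e ∈ T} α_e f_e(T)^2` of the spanning tree `T`
(each tree edge taken with its unique orientation away from the root `n0`, which does
not affect the squared flows). -/
noncomputable def treeCost {V : Type*} [Fintype V] (T : SimpleGraph V) (n0 : V)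
    (f : V → ℝ) (α : Sym2 V → ℝ) : ℝ :=
  ∑ p : V × V,
    if OrientedEdge T n0 p.1 p.2 then α s(p.1, p.2) * (edgeFlow T n0 f p.1 p.2) ^ 2
    else 0

/-- The node set of the forward mapping: the two source nodes `y, z` (encoded as
`Fin 2`), the nodes `s_{i,ℓ}` for `i, ℓ ∈ {1,…,μ}`, and the nodes `u_{j,ℓ}` for
`j ∈ {1,…,ν}`, `ℓ ∈ {1,…,μ}`. -/
abbrev SCNode (ν μ : ℕ) := Fin 2 ⊕ ((Fin μ × Fin μ) ⊕ (Fin ν × Fin μ))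

def yNode (ν μ : ℕ) : SCNode ν μ := Sum.inl 0
def zNode (ν μ : ℕ) : SCNode ν μ := Sum.inl 1
def sNode (ν μ : ℕ) (i l : Fin μ) : SCNode ν μ := Sum.inr (Sum.inl (i, l))
def uNode (ν μ : ℕ) (j : Fin ν) (l : Fin μ) : SCNode ν μ := Sum.inr (Sum.inr (j, l))

/-- The edges of the forward mapping: `{y,z}`; `{y, s_{i,ℓ}}` and `{z, s_{i,ℓ}}` for
all `i, ℓ`; and `{s_{i,ℓ}, u_{j,ℓ}}` whenever `u_j ∈ S_i`. -/
def scEdges (ν μ : ℕ) (Sets : Fin μ → Finset (Fin ν)) : Set (Sym2 (SCNode ν μ)) :=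
  {s(yNode ν μ, zNode ν μ)} ∪
  {e | ∃ i l, e = s(yNode ν μ, sNode ν μ i l) ∨ e = s(zNode ν μ, sNode ν μ i l)} ∪
  {e | ∃ i l j, j ∈ Sets i ∧ e = s(sNode ν μ i l, uNode ν μ j l)}

/-- The graph `G` of the MDST instance produced by the forward mapping. -/
def scGraph (ν μ : ℕ) (Sets : Fin μ → Finset (Fin ν)) : SimpleGraph (SCNode ν μ) :=
  SimpleGraph.fromEdgeSet (scEdges ν μ Sets)

/-- The demands of the forward mapping: `f_y = -μ²`, `f_z = -ν μ³`, `f_v = 1` for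
`v ∈ V_S`, and `f_v = μ²` for `v ∈ V_U`. -/
noncomputable def scDemand (ν μ : ℕ) : SCNode ν μ → ℝ
  | Sum.inl i => if i = 0 then -((μ : ℝ) ^ 2) else -((ν : ℝ) * (μ : ℝ) ^ 3)
  | Sum.inr (Sum.inl _) => 1
  | Sum.inr (Sum.inr _) => (μ : ℝ) ^ 2

/-- The dissipation constants of the forward mapping: `α_e = 1` for edges incident to
`y`, and `α_e = 0` otherwise. -/
noncomputable def scAlpha (ν μ : ℕ) (e : Sym2 (SCNode ν μ)) : ℝ :=
  if yNode ν μ ∈ e then 1 else 0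

/-- The cost of a solution (spanning tree) `T` of the MDST instance produced by the
forward mapping. -/
noncomputable def scCost (ν μ : ℕ) (T : SimpleGraph (SCNode ν μ)) : ℝ :=
  treeCost T (yNode ν μ) (scDemand ν μ) (scAlpha ν μ)

/-- The node `v` has degree at least `2` in the graph `T`. -/
def DegTwo {W : Type*} (T : SimpleGraph W) (v : W) : Prop :=
  2 ≤ {w | T.Adj v w}.ncard

/-- The optimum of the Set Cover instance: the minimum cardinality of a subcollection
covering the universe. -/
noncomputable def OPTsc (ν μ : ℕ) (Sets : Fin μ → Finset (Fin ν)) : ℕ :=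
  sInf {k : ℕ | ∃ x : Finset (Fin μ), (∀ j : Fin ν, ∃ i ∈ x, j ∈ Sets i) ∧ x.card = k}

/-- The optimum of the MDST instance produced by the forward mapping: the minimum
dissipation cost over all spanning trees of its graph. -/
noncomputable def OPTmdst (ν μ : ℕ) (Sets : Fin μ → Finset (Fin ν)) : ℝ :=
  sInf {c : ℝ | ∃ T : SimpleGraph (SCNode ν μ),
    IsSpanningTreeOf (scGraph ν μ Sets) T ∧ c = scCost ν μ T}

section Downward

variable {V : Type*} {T : SimpleGraph V} {r : V} {e : Sym2 V}

lemma Downward.mem_edges {u : V} (h : Downward T r e u) (p : T.Walk r u) : e ∈ p.edges :=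
  p.edges_bypass_subset_edges (h _ p.bypass_isPath)

lemma not_downward_root : ¬ Downward T r e r := fun h => by
  simpa using h.mem_edges Walk.nil

/-- Following an edge other than `e` into a downward node starts from a downward node. -/
lemma Downward.of_adj {v w : V} (hw : Downward T r e w) (hadj : T.Adj v w)
    (he : s(v, w) ≠ e) : Downward T r e v := fun p _ => by
  have h := hw.mem_edges (p.concat hadj)
  rw [Walk.edges_concat, List.concat_eq_append, List.mem_append, List.mem_singleton] at h
  exact h.resolve_right fun h => he h.symm

/-- In a tree, each node other than the root is downward of exactly one edge at the root. -/
lemma SimpleGraph.IsTree.exists_downward_iff (hT : T.IsTree) {v : V} (hv : v ≠ r) :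
    ∃ c, T.Adj r c ∧ ∀ c', Downward T r s(r, c') v ↔ c' = c := by
  obtain ⟨p, hp⟩ := hT.connected.exists_isPath r v
  cases p with
  | nil => exact absurd rfl hv
  | @cons _ c _ hadj q =>
    refine ⟨c, hadj, fun c' => ⟨fun h => ?_, ?_⟩⟩
    · have hmem := h _ hp
      rw [Walk.edges_cons, List.mem_cons] at hmem
      rcases hmem with hmem | hmem
      · exact Sym2.congr_right.1 hmem
      · exact absurd (q.fst_mem_support_of_mem_edges hmem) (Walk.cons_isPath_iff _ _ |>.1 hp).2
    · rintro rfl p' hp'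
      have : p' = Walk.cons hadj q := by
        simpa using congrArg Subtype.val
          ((hT.isAcyclic.subsingleton_path _ _).elim ⟨p', hp'⟩ ⟨_, hp⟩)
      simp [this]

lemma SimpleGraph.IsTree.orientedEdge_root (hT : T.IsTree) {c : V} (h : T.Adj r c) :
    OrientedEdge T r r c := by
  refine ⟨h, fun p hp => ?_⟩
  have : p = h.toWalk := by
    simpa using congrArg Subtype.val
      ((hT.isAcyclic.subsingleton_path _ _).elim ⟨p, hp⟩
        ⟨h.toWalk, by simp [Walk.cons_isPath_iff, h.ne]⟩)
  simp [this]

end Downward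

section Cost

variable {ν μ : ℕ}

/-- Only the edges leaving `y` contribute to the cost. -/
lemma scCost_eq_sum (T : SimpleGraph (SCNode ν μ)) :
    scCost ν μ T = ∑ b, if OrientedEdge T (yNode ν μ) (yNode ν μ) b then
      edgeFlow T (yNode ν μ) (scDemand ν μ) (yNode ν μ) b ^ 2 else 0 := by
  rw [scCost, treeCost, Fintype.sum_prod_type, Finset.sum_eq_single (yNode ν μ)]
  · simp [scAlpha]
  · intro a _ ha
    refine Finset.sum_eq_zero fun b _ => ?_
    split_ifs with h
    · have hb : yNode ν μ ≠ b := by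
        rintro rfl
        exact not_downward_root h.2
      simp [scAlpha, ha.symm, hb]
    · rfl
  · simp

lemma scCost_nonneg (T : SimpleGraph (SCNode ν μ)) : 0 ≤ scCost ν μ T := by
  rw [scCost_eq_sum]
  exact Finset.sum_nonneg fun b _ => by split_ifs <;> positivity

lemma sq_edgeFlow_le_scCost {T : SimpleGraph (SCNode ν μ)} (hT : T.IsTree) {c : SCNode ν μ}
    (hc : T.Adj (yNode ν μ) c) :
    edgeFlow T (yNode ν μ) (scDemand ν μ) (yNode ν μ) c ^ 2 ≤ scCost ν μ T := by
  rw [scCost_eq_sum]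
  refine le_trans (by rw [if_pos (hT.orientedEdge_root hc)])
    (Finset.single_le_sum (fun b _ => ?_) (Finset.mem_univ c))
  split_ifs <;> positivity

lemma sum_scNode (g : SCNode ν μ → ℝ) :
    ∑ v, g v = g (yNode ν μ) + g (zNode ν μ) +
      ((∑ i, ∑ l, g (sNode ν μ i l)) + ∑ j, ∑ l, g (uNode ν μ j l)) := by
  simp [Fintype.sum_sum_type, Fintype.sum_prod_type, yNode, zNode, sNode, uNode]

lemma scNode_cases {P : SCNode ν μ → Prop} (hy : P (yNode ν μ)) (hz : P (zNode ν μ))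
    (hs : ∀ i l, P (sNode ν μ i l)) (hu : ∀ j l, P (uNode ν μ j l)) (v : SCNode ν μ) : P v := by
  rcases v with a | ⟨i, l⟩ | ⟨j, l⟩
  · fin_cases a
    exacts [hy, hz]
  · exact hs i l
  · exact hu j l

@[simp] lemma scDemand_yNode : scDemand ν μ (yNode ν μ) = -((μ : ℝ) ^ 2) := by
  simp [scDemand, yNode]

@[simp] lemma scDemand_zNode : scDemand ν μ (zNode ν μ) = -((ν : ℝ) * (μ : ℝ) ^ 3) := by
  simp [scDemand, zNode]

@[simp] lemma scDemand_sNode (i l : Fin μ) : scDemand ν μ (sNode ν μ i l) = 1 := rfl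

@[simp] lemma scDemand_uNode (j : Fin ν) (l : Fin μ) :
    scDemand ν μ (uNode ν μ j l) = (μ : ℝ) ^ 2 := rfl

lemma sum_scDemand : ∑ v, scDemand ν μ v = 0 := by
  rw [sum_scNode]
  simp
  ring

@[simp] lemma zNode_ne_yNode : zNode ν μ ≠ yNode ν μ := by simp [zNode, yNode]
@[simp] lemma sNode_ne_yNode (i l : Fin μ) : sNode ν μ i l ≠ yNode ν μ := by
  simp [sNode, yNode]
@[simp] lemma sNode_ne_zNode (i l : Fin μ) : sNode ν μ i l ≠ zNode ν μ := by
  simp [sNode, zNode]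
@[simp] lemma uNode_ne_yNode (j : Fin ν) (l : Fin μ) : uNode ν μ j l ≠ yNode ν μ := by
  simp [uNode, yNode]
@[simp] lemma uNode_ne_zNode (j : Fin ν) (l : Fin μ) : uNode ν μ j l ≠ zNode ν μ := by
  simp [uNode, zNode]
@[simp] lemma uNode_ne_sNode (j : Fin ν) (i l l' : Fin μ) :
    uNode ν μ j l ≠ sNode ν μ i l' := by
  simp [uNode, sNode]
@[simp] lemma sNode_inj (i i' l l' : Fin μ) :
    sNode ν μ i l = sNode ν μ i' l' ↔ i = i' ∧ l = l' := by
  simp [sNode]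

end Cost

section LowerBound

variable {ν μ : ℕ} {T : SimpleGraph (SCNode ν μ)}

lemma sq_le_edgeFlow {c : SCNode ν μ}
    (hz : ¬ Downward T (yNode ν μ) s(yNode ν μ, c) (zNode ν μ)) {j : Fin ν} {l : Fin μ}
    (hu : Downward T (yNode ν μ) s(yNode ν μ, c) (uNode ν μ j l)) :
    (μ : ℝ) ^ 2 ≤ edgeFlow T (yNode ν μ) (scDemand ν μ) (yNode ν μ) c := by
  refine le_trans (by rw [if_pos hu, scDemand_uNode])
    (Finset.single_le_sum (fun v _ => ?_) (Finset.mem_univ (uNode ν μ j l)))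
  induction v using scNode_cases with
  | hy => simp [not_downward_root]
  | hz => simp [hz]
  | hs => split_ifs <;> simp
  | hu => split_ifs <;> simp

lemma adj_sNode {Sets : Fin μ → Finset (Fin ν)} {i l : Fin μ} {w : SCNode ν μ}
    (h : (scGraph ν μ Sets).Adj (sNode ν μ i l) w) :
    w = yNode ν μ ∨ w = zNode ν μ ∨ ∃ j, w = uNode ν μ j l := by
  induction w using scNode_cases with
  | hy => simp
  | hz => simp
  | hs i' l' =>
    simp [scGraph, scEdges, (uNode_ne_sNode _ _ _ _).symm] at h
  | hu j l' =>
    simp [scGraph, scEdges, (uNode_ne_sNode _ _ _ _).symm] at h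
    simp_all [uNode]

/-- If every element node hangs below the edge from `y` to `c` that leads to `z`, then a set node
that does not is a leaf. -/
lemma downward_of_degTwo {Sets : Fin μ → Finset (Fin ν)} (hT : T ≤ scGraph ν μ Sets)
    {c : SCNode ν μ} (hz : Downward T (yNode ν μ) s(yNode ν μ, c) (zNode ν μ))
    (hu : ∀ j l, Downward T (yNode ν μ) s(yNode ν μ, c) (uNode ν μ j l)) {i l : Fin μ}
    (hdeg : DegTwo T (sNode ν μ i l)) :
    Downward T (yNode ν μ) s(yNode ν μ, c) (sNode ν μ i l) := by
  by_contra hs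
  have hsub : {w | T.Adj (sNode ν μ i l) w} ⊆ {yNode ν μ} := by
    intro w (hw : T.Adj _ w)
    by_contra hwy
    have hne : s(sNode ν μ i l, w) ≠ s(yNode ν μ, c) := by
      simp only [Set.mem_singleton_iff] at hwy
      simp [hwy]
    rcases adj_sNode (hT hw) with rfl | rfl | ⟨j, rfl⟩
    · exact hwy rfl
    · exact hs (hz.of_adj hw hne)
    · exact hs ((hu j l).of_adj hw hne)
  have := Set.ncard_le_ncard hsub
  rw [Set.ncard_singleton] at this
  unfold DegTwo at hdeg
  omega

/-- If every layer has at least `k` set nodes of degree at least two, the cost is at least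
`(kμ)²`. -/
lemma sq_mul_sq_le_scCost {Sets : Fin μ → Finset (Fin ν)}
    (hT : IsSpanningTreeOf (scGraph ν μ Sets) T) {k : ℕ} (hkμ : k ≤ μ) (hk : ∀ l, k ≤ {i : Fin μ | DegTwo T (sNode ν μ i l)}.ncard) :
    ((k : ℝ) * μ) ^ 2 ≤ scCost ν μ T := by
  obtain ⟨c, hc, hcz⟩ := hT.2.exists_downward_iff (zNode_ne_yNode (ν := ν) (μ := μ))
  have hz := (hcz c).2 rfl
  by_cases hu : ∀ j l, Downward T (yNode ν μ) s(yNode ν μ, c) (uNode ν μ j l)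
  · refine le_trans ?_ (sq_edgeFlow_le_scCost hT.2 hc)
    refine pow_le_pow_left₀ (by positivity) ?_ 2
    have hsplit : edgeFlow T (yNode ν μ) (scDemand ν μ) (yNode ν μ) c =
        -∑ v, if Downward T (yNode ν μ) s(yNode ν μ, c) v then 0 else scDemand ν μ v := by
      rw [eq_neg_iff_add_eq_zero, edgeFlow, ← Finset.sum_add_distrib]
      exact (Finset.sum_congr rfl fun v _ => by split_ifs <;> simp).trans sum_scDemand
    have hleaf : ∑ i, ∑ l, (if Downward T (yNode ν μ) s(yNode ν μ, c) (sNode ν μ i l) then (0 : ℝ)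
        else 1) ≤ μ * (μ - k) := by
      rw [Finset.sum_comm]
      calc _ ≤ ∑ l : Fin μ, ((μ : ℝ) - k) := Finset.sum_le_sum fun l _ => ?_
        _ = _ := by rw [Finset.sum_const, Finset.card_fin, nsmul_eq_mul]
      calc _ ≤ ∑ i : Fin μ, ((1 : ℝ) - if DegTwo T (sNode ν μ i l) then 1 else 0) := by
            refine Finset.sum_le_sum fun i _ => ?_
            by_cases hd : DegTwo T (sNode ν μ i l)
            · simp [hd, downward_of_degTwo hT.1 hz hu hd]
            · split_ifs <;> simp
        _ ≤ _ := by
            have h : (k : ℝ) ≤ ({i : Fin μ | DegTwo T (sNode ν μ i l)}.ncard : ℝ) := by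
              exact_mod_cast hk l
            rw [Set.ncard_eq_toFinset_card', Set.toFinset_ofPred] at h
            rw [Finset.sum_sub_distrib, Finset.sum_boole, Finset.sum_const, Finset.card_fin,
              nsmul_one]
            gcongr
    rw [hsplit, sum_scNode]
    simp only [not_downward_root, hz, hu, scDemand_yNode, scDemand_sNode, if_true, if_false,
      Finset.sum_const_zero]
    linarith
  · push Not at hu
    obtain ⟨j, l, hjl⟩ := hu
    obtain ⟨d, hd, hdu⟩ := hT.2.exists_downward_iff (uNode_ne_yNode (ν := ν) (μ := μ) j l)
    have hdz : ¬ Downward T (yNode ν μ) s(yNode ν μ, d) (zNode ν μ) := fun h => by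
      rw [hcz] at h
      exact hjl ((hdu c).2 h.symm)
    refine le_trans (pow_le_pow_left₀ (by positivity) ?_ 2) (sq_edgeFlow_le_scCost hT.2 hd)
    refine le_trans ?_ (sq_le_edgeFlow hdz ((hdu d).2 rfl))
    have : (k : ℝ) ≤ μ := by exact_mod_cast hkμ
    nlinarith [Nat.cast_nonneg (α := ℝ) μ]

end LowerBound

section UpperBound

variable {ν μ : ℕ}

/-- The parent of a node in the tree rooted at `y` built from a cover `x` and an assignment `σ` of
a covering set to each element. -/
noncomputable def coverParent (x : Finset (Fin μ)) (σ : Fin ν → Fin μ) : SCNode ν μ → SCNode ν μ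
  | Sum.inl _ => yNode ν μ
  | Sum.inr (Sum.inl (i, _)) => if i ∈ x then zNode ν μ else yNode ν μ
  | Sum.inr (Sum.inr (j, l)) => sNode ν μ (σ j) l

/-- The tree built from a cover: chosen set nodes hang from `z`, the other set nodes and `z` hang
from `y`, and element nodes hang from their assigned set node. -/
noncomputable def coverTree (x : Finset (Fin μ)) (σ : Fin ν → Fin μ) :
    SimpleGraph (SCNode ν μ) :=
  SimpleGraph.fromEdgeSet ((fun v => s(v, coverParent x σ v)) '' {yNode ν μ}ᶜ)

variable {x : Finset (Fin μ)} {σ : Fin ν → Fin μ}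

lemma coverParent_zNode : coverParent x σ (zNode ν μ) = yNode ν μ := rfl

lemma coverParent_sNode (i l : Fin μ) :
    coverParent x σ (sNode ν μ i l) = if i ∈ x then zNode ν μ else yNode ν μ := rfl

lemma coverParent_uNode (j : Fin ν) (l : Fin μ) :
    coverParent x σ (uNode ν μ j l) = sNode ν μ (σ j) l := rfl

lemma coverTree_adj_parent {v : SCNode ν μ} (hv : v ≠ yNode ν μ) :
    (coverTree x σ).Adj v (coverParent x σ v) := by
  refine (SimpleGraph.fromEdgeSet_adj _).2 ⟨⟨v, hv, rfl⟩, ?_⟩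
  induction v using scNode_cases with
  | hy => exact absurd rfl hv
  | hz => simp [coverParent_zNode]
  | hs i l => rw [coverParent_sNode]; split_ifs <;> simp
  | hu j l => simp [coverParent_uNode]

lemma coverTree_reachable (v : SCNode ν μ) : (coverTree x σ).Reachable v (yNode ν μ) := by
  have hz : (coverTree x σ).Reachable (zNode ν μ) (yNode ν μ) :=
    (coverTree_adj_parent zNode_ne_yNode).reachable
  have hs : ∀ i l, (coverTree x σ).Reachable (sNode ν μ i l) (yNode ν μ) := fun i l => by
    have h := (coverTree_adj_parent (x := x) (σ := σ) (sNode_ne_yNode i l)).reachable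
    rw [coverParent_sNode] at h
    split_ifs at h
    exacts [h.trans hz, h]
  induction v using scNode_cases with
  | hy => rfl
  | hz => exact hz
  | hs i l => exact hs i l
  | hu j l => exact (coverTree_adj_parent (uNode_ne_yNode j l)).reachable.trans (hs _ _)

lemma coverTree_isTree : (coverTree (ν := ν) x σ).IsTree := by
  have hconn : (coverTree (ν := ν) x σ).Connected :=
    { preconnected := fun v w => (coverTree_reachable v).trans (coverTree_reachable w).symm
      nonempty := ⟨yNode ν μ⟩ }
  refine isTree_iff_connected_and_card.2 ⟨hconn, le_antisymm ?_
    hconn.card_vert_le_card_edgeSet_add_one⟩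
  have hle : Nat.card (coverTree (ν := ν) x σ).edgeSet ≤
      ({yNode ν μ}ᶜ : Set (SCNode ν μ)).ncard := by
    rw [Nat.card_coe_set_eq, coverTree, edgeSet_fromEdgeSet]
    exact (Set.ncard_le_ncard Set.sdiff_subset).trans (Set.ncard_image_le)
  have := Set.ncard_add_ncard_compl ({yNode ν μ} : Set (SCNode ν μ))
  rw [Set.ncard_singleton] at this
  omega

lemma coverTree_le {Sets : Fin μ → Finset (Fin ν)} (hσ : ∀ j, j ∈ Sets (σ j)) :
    coverTree x σ ≤ scGraph ν μ Sets := by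
  refine SimpleGraph.fromEdgeSet_mono ?_
  rintro _ ⟨v, hv, rfl⟩
  induction v using scNode_cases with
  | hy => exact absurd rfl hv
  | hz => exact Or.inl (Or.inl Sym2.eq_swap)
  | hs i l =>
    refine Or.inl (Or.inr ⟨i, l, ?_⟩)
    simp only [coverParent_sNode]
    split_ifs
    exacts [Or.inr Sym2.eq_swap, Or.inl Sym2.eq_swap]
  | hu j l => exact Or.inr ⟨σ j, l, j, hσ j, Sym2.eq_swap⟩

/-- A node hangs below an edge at `y` as soon as its parent does. -/
lemma coverTree_downward_iff {v : SCNode ν μ} {b : SCNode ν μ} (hv : v ≠ yNode ν μ)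
    (hne : s(v, coverParent x σ v) ≠ s(yNode ν μ, b)) :
    Downward (coverTree x σ) (yNode ν μ) s(yNode ν μ, b) v ↔
      Downward (coverTree x σ) (yNode ν μ) s(yNode ν μ, b) (coverParent x σ v) :=
  ⟨fun h => h.of_adj (coverTree_adj_parent hv).symm (by rwa [Sym2.eq_swap]),
    fun h => h.of_adj (coverTree_adj_parent hv) hne⟩

lemma coverTree_adj_yNode {b : SCNode ν μ} (h : (coverTree x σ).Adj (yNode ν μ) b) :
    b = zNode ν μ ∨ ∃ i l, i ∉ x ∧ b = sNode ν μ i l := by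
  obtain ⟨⟨v, hv, hvb⟩, -⟩ := (SimpleGraph.fromEdgeSet_adj _).1 h
  obtain ⟨rfl, -⟩ | ⟨rfl, hp⟩ := Sym2.eq_iff.1 hvb
  · exact absurd rfl hv
  induction v using scNode_cases with
  | hy => exact absurd rfl hv
  | hz => exact Or.inl rfl
  | hs i l =>
    refine Or.inr ⟨i, l, fun hi => ?_, rfl⟩
    simp [coverParent_sNode, hi] at hp
  | hu j l => simp [coverParent_uNode] at hp

lemma edgeFlow_coverTree_zNode (hσ : ∀ j, σ j ∈ x) :
    edgeFlow (coverTree x σ) (yNode ν μ) (scDemand ν μ) (yNode ν μ) (zNode ν μ) =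
      x.card * μ := by
  have hz : Downward (coverTree x σ) (yNode ν μ) s(yNode ν μ, zNode ν μ) (zNode ν μ) :=
    (coverTree_isTree.orientedEdge_root (coverTree_adj_parent zNode_ne_yNode).symm).2
  have hs : ∀ i l, Downward (coverTree x σ) (yNode ν μ) s(yNode ν μ, zNode ν μ) (sNode ν μ i l) ↔
      i ∈ x := fun i l => by
    rw [coverTree_downward_iff (sNode_ne_yNode i l) (by simp), coverParent_sNode]
    split_ifs with hi <;> simp [hi, hz, not_downward_root]
  have hu : ∀ j l,
      Downward (coverTree x σ) (yNode ν μ) s(yNode ν μ, zNode ν μ) (uNode ν μ j l) := fun j l => by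
    rw [coverTree_downward_iff (uNode_ne_yNode j l) (by simp), coverParent_uNode, hs]
    exact hσ j
  rw [edgeFlow, sum_scNode]
  simp [hz, hs, hu, not_downward_root]
  ring

lemma edgeFlow_coverTree_sNode (hσ : ∀ j, σ j ∈ x) {i l : Fin μ} (hi : i ∉ x) :
    edgeFlow (coverTree x σ) (yNode ν μ) (scDemand ν μ) (yNode ν μ) (sNode ν μ i l) = 1 := by
  have hb : Downward (coverTree x σ) (yNode ν μ) s(yNode ν μ, sNode ν μ i l) (sNode ν μ i l) := by
    have h := coverTree_adj_parent (x := x) (σ := σ) (sNode_ne_yNode i l)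
    rw [coverParent_sNode, if_neg hi] at h
    exact (coverTree_isTree.orientedEdge_root h.symm).2
  have hz : ¬ Downward (coverTree x σ) (yNode ν μ) s(yNode ν μ, sNode ν μ i l) (zNode ν μ) := by
    rw [coverTree_downward_iff zNode_ne_yNode
      (by simp [(sNode_ne_zNode _ _).symm]), coverParent_zNode]
    exact not_downward_root
  have hs : ∀ i' l', sNode ν μ i' l' ≠ sNode ν μ i l →
      ¬ Downward (coverTree x σ) (yNode ν μ) s(yNode ν μ, sNode ν μ i l) (sNode ν μ i' l') := by
    intro i' l' hne
    rw [coverTree_downward_iff (sNode_ne_yNode i' l')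
      (fun h => by rcases Sym2.eq_iff.1 h with h | h <;> simp_all), coverParent_sNode]
    split_ifs
    exacts [hz, not_downward_root]
  rw [edgeFlow, Finset.sum_eq_single (sNode ν μ i l)]
  · simp [hb]
  · intro v _ hv
    refine if_neg ?_
    induction v using scNode_cases with
    | hy => exact not_downward_root
    | hz => exact hz
    | hs i' l' => exact hs i' l' hv
    | hu j l' =>
      rw [coverTree_downward_iff (uNode_ne_yNode j l')
        (by simp), coverParent_uNode]
      refine hs _ _ fun h => hi ?_
      rw [← ((sNode_inj _ _ _ _).1 h).1]
      exact hσ j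
  · simp

lemma scCost_coverTree_le (hσ : ∀ j, σ j ∈ x) :
    scCost ν μ (coverTree x σ) ≤ ((x.card : ℝ) * μ) ^ 2 + (μ : ℝ) ^ 2 := by
  rw [scCost_eq_sum, sum_scNode]
  have hy : ¬ OrientedEdge (coverTree x σ) (yNode ν μ) (yNode ν μ) (yNode ν μ) :=
    fun h => h.1.ne rfl
  have hu : ∀ j l, ¬ OrientedEdge (coverTree x σ) (yNode ν μ) (yNode ν μ) (uNode ν μ j l) :=
    fun j l h => by simpa using coverTree_adj_yNode h.1
  simp only [hy, hu, if_false, zero_add, Finset.sum_const_zero, add_zero,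
    edgeFlow_coverTree_zNode hσ]
  gcongr
  · split_ifs
    · rfl
    · positivity
  · calc _ ≤ ∑ _i : Fin μ, ∑ _l : Fin μ, (1 : ℝ) := by
          refine Finset.sum_le_sum fun i _ => Finset.sum_le_sum fun l _ => ?_
          split_ifs with h
          · have hi : i ∉ x := by simpa using coverTree_adj_yNode h.1
            simp [edgeFlow_coverTree_sNode hσ hi]
          · exact zero_le_one
      _ = (μ : ℝ) ^ 2 := by simp [sq]

end UpperBound

lemma exists_cover_card_eq_OPTsc {ν μ : ℕ} {Sets : Fin μ → Finset (Fin ν)}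
    (hcover : ∀ j : Fin ν, ∃ i : Fin μ, j ∈ Sets i) :
    ∃ x : Finset (Fin μ), (∀ j : Fin ν, ∃ i ∈ x, j ∈ Sets i) ∧ x.card = OPTsc ν μ Sets :=
  Nat.sInf_mem (s := {k : ℕ | ∃ x : Finset (Fin μ),
    (∀ j : Fin ν, ∃ i ∈ x, j ∈ Sets i) ∧ x.card = k})
    ⟨_, Finset.univ, fun j => by simpa using hcover j, rfl⟩

lemma OPTmdst_le {ν μ : ℕ} {Sets : Fin μ → Finset (Fin ν)} {x : Finset (Fin μ)}
    (hx : ∀ j : Fin ν, ∃ i ∈ x, j ∈ Sets i) :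
    OPTmdst ν μ Sets ≤ ((x.card : ℝ) * μ) ^ 2 + (μ : ℝ) ^ 2 := by
  choose σ hσx hσ using hx
  have h : OPTmdst ν μ Sets ≤ scCost ν μ (coverTree x σ) := by
    refine csInf_le ⟨0, ?_⟩ ⟨coverTree x σ, ⟨coverTree_le hσ, coverTree_isTree⟩, rfl⟩
    rintro _ ⟨T, -, rfl⟩
    exact scCost_nonneg T
  exact h.trans (scCost_coverTree_le hσx)

/-- Let `T` be a spanning tree of the graph of the MDST instance
produced by the forward mapping, and let `x` be the set cover obtained from `T` by the
backward mapping (choose `ℓ` minimizing the number of degree-`≥2` nodes of `V_{S,ℓ}`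
in `T`, and take `x = { S_i : s_{i,ℓ} has degree ≥ 2 in T }`).  If
`C(T) ≤ ρ · OPT(I')` for some real `ρ ≥ 1`, then `|x| ≤ √(2ρ) · OPT(I)`. -/
theorem stmt14 (ν μ : ℕ) (hν : 1 ≤ ν) (Sets : Fin μ → Finset (Fin ν))
    (hcover : ∀ j : Fin ν, ∃ i : Fin μ, j ∈ Sets i)
    (T : SimpleGraph (SCNode ν μ)) (hT : IsSpanningTreeOf (scGraph ν μ Sets) T)
    (l : Fin μ)
    (hl : ∀ l' : Fin μ,
      {i : Fin μ | DegTwo T (sNode ν μ i l)}.ncard ≤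
        {i : Fin μ | DegTwo T (sNode ν μ i l')}.ncard)
    (ρ : ℝ) (hρ : 1 ≤ ρ)
    (hcost : scCost ν μ T ≤ ρ * OPTmdst ν μ Sets) :
    ({i : Fin μ | DegTwo T (sNode ν μ i l)}.ncard : ℝ) ≤
      Real.sqrt (2 * ρ) * (OPTsc ν μ Sets : ℝ) := by
  obtain ⟨x, hx, hxcard⟩ := exists_cover_card_eq_OPTsc hcover
  set k := {i : Fin μ | DegTwo T (sNode ν μ i l)}.ncard
  have hkμ : k ≤ μ := by
    simpa using Set.ncard_le_card {i : Fin μ | DegTwo T (sNode ν μ i l)}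
  have hμ : (0 : ℝ) < μ := by exact_mod_cast l.pos
  have hone : (1 : ℝ) ≤ OPTsc ν μ Sets := by
    obtain ⟨i, hi, -⟩ := hx ⟨0, hν⟩
    rw [← hxcard]
    exact_mod_cast Finset.card_pos.2 ⟨i, hi⟩
  have hlower := sq_mul_sq_le_scCost hT hkμ hl
  have hupper := OPTmdst_le hx
  rw [hxcard] at hupper
  have hchain : ((k : ℝ) * μ) ^ 2 ≤ 2 * ρ * (OPTsc ν μ Sets : ℝ) ^ 2 * (μ : ℝ) ^ 2 := by
    have hle : OPTmdst ν μ Sets ≤ 2 * (OPTsc ν μ Sets : ℝ) ^ 2 * (μ : ℝ) ^ 2 := by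
      nlinarith [mul_le_mul_of_nonneg_right (one_le_pow₀ hone (n := 2)) (sq_nonneg (μ : ℝ))]
    calc _ ≤ ρ * OPTmdst ν μ Sets := hlower.trans hcost
      _ ≤ ρ * (2 * (OPTsc ν μ Sets : ℝ) ^ 2 * (μ : ℝ) ^ 2) := by gcongr
      _ = _ := by ring
  have hsq : (k : ℝ) ^ 2 ≤ 2 * ρ * (OPTsc ν μ Sets : ℝ) ^ 2 := by
    rw [mul_pow] at hchain
    exact le_of_mul_le_mul_right hchain (by positivity)
  calc (k : ℝ) ≤ √(2 * ρ * (OPTsc ν μ Sets : ℝ) ^ 2) := Real.le_sqrt_of_sq_le hsq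
    _ = _ := by rw [Real.sqrt_mul (by positivity), Real.sqrt_sq (by positivity)]
end
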